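/- Let p, q and p′, q′ be two pairs of relatively prime positive integers. Then the subshift generated by S(0,q/p) is conjugate to the subshift generated by S′(0,q′/p′) if and only if q′ = p and p′ = q (i.e., the two sequences have inverse frequencies). -/

import Mathlib

open Classical

/-- The shift map `σ` on bi-infinite sequences: `σ(x)_i = x_{i+1}`. -/
def shiftMap {A : Type*} (x : ℤ → A) : ℤ → A := fun i => x (i + 1)

/-- The iterated shift `σ^k` for `k ∈ ℤ`: `σ^k(x)_i = x_{i+k}`. -/
def shiftZ {A : Type*} (k : ℤ) (x : ℤ → A) : ℤ → A := fun i => x (i + k)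

/-- `x` is periodic with period `N > 0`, i.e. `σ^N(x) = x`. -/
def IsPeriodicWith {A : Type*} (x : ℤ → A) (N : ℕ) : Prop :=
  0 < N ∧ ∀ i : ℤ, x (i + N) = x i

/-- `x` is periodic (with some period `N > 0`). -/
def IsPeriodicSeq {A : Type*} (x : ℤ → A) : Prop := ∃ N : ℕ, IsPeriodicWith x N

/-- The sequence `p(x;i,n)` obtained from `x` by removing the block `x_{i+1} ⋯ x_{i+n}`. -/
def removeBlock {A : Type*} (x : ℤ → A) (i : ℤ) (n : ℕ) : ℤ → A :=
  fun k => if k ≤ i then x k else x (k + n)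

/-- `(i,n)` is an anomaly occurrence of `x`: `n > 0` and `p(x;i,n)` is periodic. -/
def IsAnomalyOcc {A : Type*} (x : ℤ → A) (i : ℤ) (n : ℕ) : Prop :=
  0 < n ∧ IsPeriodicSeq (removeBlock x i n)

/-- `x` is eventually periodic: non-periodic, but removing some block leaves a periodic sequence. -/
def EventuallyPeriodic {A : Type*} (x : ℤ → A) : Prop :=
  ¬ IsPeriodicSeq x ∧ ∃ (i : ℤ) (n : ℕ), IsAnomalyOcc x i n

/-- The least period of an eventually periodic sequence `x`: the least period of
`p(x;i,n)` over anomaly occurrences `(i,n)` of `x`. -/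
noncomputable def evLeastPeriod {A : Type*} (x : ℤ → A) : ℕ :=
  sInf {N : ℕ | ∃ (i : ℤ) (n : ℕ), IsAnomalyOcc x i n ∧ IsPeriodicWith (removeBlock x i n) N}

/-- The anomaly size `a(x)`: the minimum of `n` over anomaly occurrences `(i,n)` of `x`. -/
noncomputable def anomalySize {A : Type*} (x : ℤ → A) : ℕ :=
  sInf {n : ℕ | ∃ i : ℤ, IsAnomalyOcc x i n}

/-- The orbit `{σ^k(x) : k ∈ ℤ}` of a bi-infinite sequence. -/
def seqOrbit {A : Type*} (x : ℤ → A) : Set (ℤ → A) := {y | ∃ k : ℤ, y = shiftZ k x}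

/-- The subshift generated by `x`: the closure of its orbit in the product topology. -/
def subshiftGen {A : Type*} [TopologicalSpace A] (x : ℤ → A) : Set (ℤ → A) :=
  closure (seqOrbit x)

/-- Two subshifts are conjugate if there is a homeomorphism between them commuting
with the shift. -/
def Conjugate {A B : Type*} [TopologicalSpace A] [TopologicalSpace B]
    (X : Set (ℤ → A)) (Y : Set (ℤ → B)) : Prop :=
  ∃ φ : X ≃ₜ Y, ∀ (u : ℤ → A) (hu : u ∈ X) (hu' : shiftMap u ∈ X),
    ((φ ⟨shiftMap u, hu'⟩ : Y) : ℤ → B) = shiftMap ((φ ⟨u, hu⟩ : Y) : ℤ → B)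

/-- The relation generating the suspension: `(x,s) ∼ (σ^n(x), s - n)`. -/
def SuspRel {A : Type*} (X : Set (ℤ → A)) : (X × ℝ) → (X × ℝ) → Prop :=
  fun p q => ∃ n : ℤ, (q.1 : ℤ → A) = shiftZ n (p.1 : ℤ → A) ∧ q.2 = p.2 - n

/-- The suspension `ΣX` of a subshift `X`. -/
def Susp {A : Type*} [TopologicalSpace A] (X : Set (ℤ → A)) : Type _ :=
  Quot (SuspRel X)

instance {A : Type*} [TopologicalSpace A] (X : Set (ℤ → A)) : TopologicalSpace (Susp X) :=
  instTopologicalSpaceQuot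

/-- The suspension flow `φ_t [x,s] = [x, s+t]`. -/
def suspFlow {A : Type*} [TopologicalSpace A] (X : Set (ℤ → A)) (t : ℝ) :
    Susp X → Susp X :=
  Quot.lift (fun p => Quot.mk _ (p.1, p.2 + t)) (by
    rintro p r ⟨n, h1, h2⟩
    exact Quot.sound ⟨n, h1, by rw [h2]; ring⟩)

/-- Two subshifts are flow equivalent if there is a homeomorphism of their suspensions
taking flow lines to flow lines in an orientation-preserving way. -/
def FlowEquiv {A B : Type*} [TopologicalSpace A] [TopologicalSpace B]
    (X : Set (ℤ → A)) (Y : Set (ℤ → B)) : Prop :=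
  ∃ h : Susp X ≃ₜ Susp Y, ∀ u : Susp X, ∃ τ : ℝ → ℝ,
    StrictMono τ ∧ Function.Bijective τ ∧ τ 0 = 0 ∧
      ∀ t : ℝ, h (suspFlow X t u) = suspFlow Y (τ t) (h u)

/-- Cell lengths `z_n` for the type-`S` skew Sturmian sequence `S(0, q/p)`, with `β = p/q`. -/
noncomputable def cellLenS (p q : ℤ) (n : ℤ) : ℕ :=
  if n < 0 then
    ({k : ℤ | (n : ℚ) < (k : ℚ) * ((p : ℚ) / (q : ℚ)) ∧
        (k : ℚ) * ((p : ℚ) / (q : ℚ)) ≤ (n : ℚ) + 1}).ncard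
  else if n = 0 then
    ({k : ℤ | 0 < (k : ℚ) * ((p : ℚ) / (q : ℚ)) ∧
        (k : ℚ) * ((p : ℚ) / (q : ℚ)) < 1}).ncard
  else
    ({k : ℤ | (n : ℚ) ≤ (k : ℚ) * ((p : ℚ) / (q : ℚ)) ∧
        (k : ℚ) * ((p : ℚ) / (q : ℚ)) < (n : ℚ) + 1}).ncard

/-- Cell lengths `z′_n` for the type-`S′` skew Sturmian sequence `S′(0, q/p)`, with `β = p/q`. -/
noncomputable def cellLenS' (p q : ℤ) (n : ℤ) : ℕ :=
  if n < 0 then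
    ({k : ℤ | (n : ℚ) ≤ (k : ℚ) * ((p : ℚ) / (q : ℚ)) ∧
        (k : ℚ) * ((p : ℚ) / (q : ℚ)) < (n : ℚ) + 1}).ncard
  else if n = 0 then
    ({k : ℤ | 0 ≤ (k : ℚ) * ((p : ℚ) / (q : ℚ)) ∧
        (k : ℚ) * ((p : ℚ) / (q : ℚ)) ≤ 1}).ncard
  else
    ({k : ℤ | (n : ℚ) < (k : ℚ) * ((p : ℚ) / (q : ℚ)) ∧
        (k : ℚ) * ((p : ℚ) / (q : ℚ)) ≤ (n : ℚ) + 1}).ncard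

/-- The position `L_n` of the leading `1` of the cell `B_n`. -/
noncomputable def cellStart (z : ℤ → ℕ) (n : ℤ) : ℤ :=
  if 0 ≤ n then n + ∑ j ∈ Finset.Ico (0 : ℤ) n, (z j : ℤ)
  else n - ∑ j ∈ Finset.Ico n (0 : ℤ), (z j : ℤ)

/-- The `{0,1}`-sequence determined by cell lengths `z`: a `1` at each position `L_n`
and `0` elsewhere. -/
noncomputable def seqOfCells (z : ℤ → ℕ) : ℤ → Fin 2 :=
  fun i => if ∃ n : ℤ, i = cellStart z n then 1 else 0

/-- The type-`S` skew Sturmian sequence `S(0, q/p)`. -/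
noncomputable def sturmS (p q : ℤ) : ℤ → Fin 2 := seqOfCells (cellLenS p q)

/-- The type-`S′` skew Sturmian sequence `S′(0, q/p)`. -/
noncomputable def sturmS' (p q : ℤ) : ℤ → Fin 2 := seqOfCells (cellLenS' p q)

/-- The periodic coding of phase `c`: a `1` at `i` iff `c - i * p` reduces mod `N` into `[0, p)`. -/
def phaseSeq (p N c : ℤ) : ℤ → Fin 2 := fun i => if (c - i * p) % N < p then 1 else 0

/-- The sequence following `phaseSeq p N a` up to position `0` and `phaseSeq p N b` afterwards. -/
def seamSeq (p N a b : ℤ) : ℤ → Fin 2 :=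
  fun i => if i ≤ 0 then phaseSeq p N a i else phaseSeq p N b i

lemma emod_lt_iff_exists {p N c : ℤ} (hp : 0 < p) (hN : p ≤ N) :
    c % N < p ↔ ∃ n : ℤ, 0 ≤ c + n * N ∧ c + n * N < p := by
  have hN0 : 0 < N := by lia
  constructor
  · intro h
    refine ⟨-(c / N), ?_⟩
    have h1 := Int.emod_add_mul_ediv c N
    have h2 := Int.emod_nonneg c hN0.ne'
    constructor <;> nlinarith
  · rintro ⟨n, h1, h2⟩
    have : c % N = c + n * N := by
      rw [← Int.add_mul_emod_self_right c n N, Int.emod_eq_of_lt h1 (by lia)]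
    lia

lemma cellStart_succ (z : ℤ → ℕ) (n : ℤ) :
    cellStart z (n + 1) = cellStart z n + 1 + z n := by
  unfold cellStart
  rcases lt_trichotomy n (-1) with h | h | h
  · rw [if_neg (by lia), if_neg (by lia),
      ← Finset.insert_Ico_add_one_left_eq_Ico (show n < 0 by lia), Finset.sum_insert (by simp)]
    ring
  · subst h
    have : Finset.Ico (-1 : ℤ) 0 = {-1} := by decide
    simp [this]
    ring
  · rw [if_pos (by lia), if_pos (by lia),
      ← Finset.insert_Ico_right_eq_Ico_add_one (show 0 ≤ n by lia), Finset.sum_insert (by simp)]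
    ring

lemma cellStart_eq_of_succ {z : ℤ → ℕ} {F : ℤ → ℤ} (h0 : F 0 = 0)
    (h : ∀ n, F (n + 1) = F n + 1 + z n) (n : ℤ) : cellStart z n = F n := by
  induction n with
  | zero => simp [cellStart, h0]
  | succ n ih => rw [cellStart_succ, h, ih]
  | pred n ih =>
    have h1 := cellStart_succ z (-(n : ℤ) - 1)
    have h2 := h (-(n : ℤ) - 1)
    rw [sub_add_cancel] at h1 h2
    lia

section Cells

variable {p q : ℤ}

lemma intCast_lt_mul_div_iff (hq : 0 < q) (m k : ℤ) :
    (m : ℚ) < (k : ℚ) * ((p : ℚ) / (q : ℚ)) ↔ m * q < k * p := by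
  have : (0 : ℚ) < q := by exact_mod_cast hq
  rw [← mul_div_assoc, lt_div_iff₀ this]
  exact_mod_cast Iff.rfl

lemma mul_div_lt_intCast_iff (hq : 0 < q) (m k : ℤ) :
    (k : ℚ) * ((p : ℚ) / (q : ℚ)) < (m : ℚ) ↔ k * p < m * q := by
  have : (0 : ℚ) < q := by exact_mod_cast hq
  rw [← mul_div_assoc, div_lt_iff₀ this]
  exact_mod_cast Iff.rfl

lemma intCast_le_mul_div_iff (hq : 0 < q) (m k : ℤ) :
    (m : ℚ) ≤ (k : ℚ) * ((p : ℚ) / (q : ℚ)) ↔ m * q ≤ k * p := by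
  rw [← not_lt, mul_div_lt_intCast_iff hq, not_lt]

lemma mul_div_le_intCast_iff (hq : 0 < q) (m k : ℤ) :
    (k : ℚ) * ((p : ℚ) / (q : ℚ)) ≤ (m : ℚ) ↔ k * p ≤ m * q := by
  rw [← not_lt, intCast_lt_mul_div_iff hq, not_lt]

lemma le_mul_iff_neg_ediv_le (hp : 0 < p) (m k : ℤ) : m ≤ k * p ↔ -(-m / p) ≤ k := by
  rw [neg_le, Int.le_ediv_iff_mul_le hp]
  constructor <;> intro h <;> linarith

lemma mul_le_iff_le_ediv (hp : 0 < p) (m k : ℤ) : k * p ≤ m ↔ k ≤ m / p :=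
  (Int.le_ediv_iff_mul_le hp).symm

lemma ncard_lt_le (hp : 0 < p) (hq : 0 < q) (m n : ℤ) (hmn : m ≤ n) :
    (({k : ℤ | (m : ℚ) < (k : ℚ) * ((p : ℚ) / (q : ℚ)) ∧
      (k : ℚ) * ((p : ℚ) / (q : ℚ)) ≤ (n : ℚ)}).ncard : ℤ) = n * q / p - m * q / p := by
  have hs : {k : ℤ | (m : ℚ) < (k : ℚ) * ((p : ℚ) / (q : ℚ)) ∧
      (k : ℚ) * ((p : ℚ) / (q : ℚ)) ≤ (n : ℚ)} = ↑(Finset.Ioc (m * q / p) (n * q / p)) := by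
    ext k
    simp only [Set.mem_ofPred_eq, intCast_lt_mul_div_iff hq, mul_div_le_intCast_iff hq,
      Finset.coe_Ioc, Set.mem_Ioc, ← mul_le_iff_le_ediv hp, ← Int.ediv_lt_iff_lt_mul hp]
  have : m * q / p ≤ n * q / p := Int.ediv_le_ediv hp (by nlinarith)
  rw [hs, Set.ncard_coe_finset, Int.card_Ioc]
  lia

lemma ncard_le_lt (hp : 0 < p) (hq : 0 < q) (m n : ℤ) (hmn : m ≤ n) :
    (({k : ℤ | (m : ℚ) ≤ (k : ℚ) * ((p : ℚ) / (q : ℚ)) ∧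
      (k : ℚ) * ((p : ℚ) / (q : ℚ)) < (n : ℚ)}).ncard : ℤ)
      = -(-(n * q) / p) - -(-(m * q) / p) := by
  have hs : {k : ℤ | (m : ℚ) ≤ (k : ℚ) * ((p : ℚ) / (q : ℚ)) ∧
      (k : ℚ) * ((p : ℚ) / (q : ℚ)) < (n : ℚ)}
      = ↑(Finset.Ico (-(-(m * q) / p)) (-(-(n * q) / p))) := by
    ext k
    simp only [Set.mem_ofPred_eq, intCast_le_mul_div_iff hq, mul_div_lt_intCast_iff hq,
      Finset.coe_Ico, Set.mem_Ico, ← le_mul_iff_neg_ediv_le hp]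
    rw [← not_le (a := n * q), le_mul_iff_neg_ediv_le hp (n * q), not_le]
  have : -(n * q) / p ≤ -(m * q) / p := Int.ediv_le_ediv hp (by nlinarith)
  rw [hs, Set.ncard_coe_finset, Int.card_Ico]
  lia

lemma ncard_pos_lt_one (hp : 0 < p) (hq : 0 < q) :
    (({k : ℤ | 0 < (k : ℚ) * ((p : ℚ) / (q : ℚ)) ∧
      (k : ℚ) * ((p : ℚ) / (q : ℚ)) < 1}).ncard : ℤ) = -(-q / p) - 1 := by
  have hs : {k : ℤ | 0 < (k : ℚ) * ((p : ℚ) / (q : ℚ)) ∧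
      (k : ℚ) * ((p : ℚ) / (q : ℚ)) < 1} = ↑(Finset.Ioo 0 (-(-q / p))) := by
    ext k
    have h1 := intCast_lt_mul_div_iff (p := p) hq 0 k
    have h2 := mul_div_lt_intCast_iff (p := p) hq 1 k
    push_cast at h1 h2
    rw [zero_mul, mul_pos_iff_of_pos_right hp] at h1
    rw [one_mul, ← not_le, ← not_le, le_mul_iff_neg_ediv_le hp, not_le, not_le] at h2
    simp only [Set.mem_ofPred_eq, h1, h2, Finset.coe_Ioo, Set.mem_Ioo]
  have : -q / p < 0 := Int.ediv_neg_of_neg_of_pos (by lia) hp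
  rw [hs, Set.ncard_coe_finset, Int.card_Ioo]
  lia

lemma ncard_nonneg_le_one (hp : 0 < p) (hq : 0 < q) :
    (({k : ℤ | 0 ≤ (k : ℚ) * ((p : ℚ) / (q : ℚ)) ∧
      (k : ℚ) * ((p : ℚ) / (q : ℚ)) ≤ 1}).ncard : ℤ) = q / p + 1 := by
  have hs : {k : ℤ | 0 ≤ (k : ℚ) * ((p : ℚ) / (q : ℚ)) ∧
      (k : ℚ) * ((p : ℚ) / (q : ℚ)) ≤ 1} = ↑(Finset.Icc 0 (q / p)) := by
    ext k
    have h1 := intCast_le_mul_div_iff (p := p) hq 0 k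
    have h2 := mul_div_le_intCast_iff (p := p) hq 1 k
    push_cast at h1 h2
    rw [zero_mul, mul_nonneg_iff_of_pos_right hp] at h1
    rw [one_mul, mul_le_iff_le_ediv hp] at h2
    simp only [Set.mem_ofPred_eq, h1, h2, Finset.coe_Icc, Set.mem_Icc]
  have : 0 ≤ q / p := Int.ediv_nonneg hq.le hp.le
  rw [hs, Set.ncard_coe_finset, Int.card_Icc]
  lia

lemma cellStart_cellLenS (hp : 0 < p) (hq : 0 < q) (n : ℤ) :
    cellStart (cellLenS p q) n = if n ≤ 0 then n + n * q / p else n + (-(-(n * q) / p) - 1) := by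
  refine cellStart_eq_of_succ (F := fun n => if n ≤ 0 then n + n * q / p
    else n + (-(-(n * q) / p) - 1)) (by simp) (fun n => ?_) n
  unfold cellLenS
  rcases lt_trichotomy n 0 with h | h | h
  · have := ncard_lt_le hp hq n (n + 1) (by lia)
    push_cast at this
    simp only [if_pos h, if_pos h.le, if_pos (show n + 1 ≤ 0 by lia), this]
    ring
  · subst h
    simp [ncard_pos_lt_one hp hq]
  · have := ncard_le_lt hp hq n (n + 1) (by lia)
    push_cast at this
    simp only [if_neg h.not_gt, if_neg h.not_ge, if_neg h.ne', if_neg (show ¬ n + 1 ≤ 0 by lia),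
      this]
    ring

lemma cellStart_cellLenS' (hp : 0 < p) (hq : 0 < q) (n : ℤ) :
    cellStart (cellLenS' p q) n = if n ≤ 0 then n + -(-(n * q) / p) else n + (n * q / p + 1) := by
  refine cellStart_eq_of_succ (F := fun n => if n ≤ 0 then n + -(-(n * q) / p)
    else n + (n * q / p + 1)) (by simp) (fun n => ?_) n
  unfold cellLenS'
  rcases lt_trichotomy n 0 with h | h | h
  · have := ncard_le_lt hp hq n (n + 1) (by lia)
    push_cast at this
    simp only [if_pos h, if_pos h.le, if_pos (show n + 1 ≤ 0 by lia), this]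
    ring
  · subst h
    simp [ncard_nonneg_le_one hp hq]
  · have := ncard_lt_le hp hq n (n + 1) (by lia)
    push_cast at this
    simp only [if_neg h.not_gt, if_neg h.not_ge, if_neg h.ne', if_neg (show ¬ n + 1 ≤ 0 by lia),
      this]
    ring

lemma eq_add_ediv_iff (hp : 0 < p) (i n : ℤ) :
    i = n + n * q / p ↔ 0 ≤ -(i * p) + n * (p + q) ∧ -(i * p) + n * (p + q) < p := by
  have h1 := Int.le_ediv_iff_mul_le (a := i - n) (b := n * q) hp
  have h2 := Int.ediv_lt_iff_lt_mul (a := n * q) (b := i - n + 1) hp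
  have h3 : i = n + n * q / p ↔ i - n ≤ n * q / p ∧ n * q / p < i - n + 1 := by lia
  rw [h3, h1, h2]
  constructor <;> rintro ⟨h, h'⟩ <;> constructor <;> nlinarith

lemma eq_add_neg_ediv_iff (hp : 0 < p) (i n : ℤ) :
    i = n + -(-(n * q) / p) ↔
      0 ≤ -1 - (i - 1) * p + n * (p + q) ∧ -1 - (i - 1) * p + n * (p + q) < p := by
  have h1 := Int.le_ediv_iff_mul_le (a := n - i) (b := -(n * q)) hp
  have h2 := Int.ediv_lt_iff_lt_mul (a := -(n * q)) (b := n - i + 1) hp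
  have h3 : i = n + -(-(n * q) / p) ↔ n - i ≤ -(n * q) / p ∧ -(n * q) / p < n - i + 1 := by lia
  rw [h3, h1, h2]
  constructor
  · rintro ⟨h, h'⟩
    constructor
    · have : (n - i) * p ≤ -(n * q) := h
      have : -(n * q) + 1 ≤ (n - i + 1) * p := h'
      nlinarith
    · nlinarith
  · rintro ⟨h, h'⟩
    constructor
    · have : -1 - (i - 1) * p + n * (p + q) + 1 ≤ p := h'
      nlinarith
    · nlinarith

lemma sturmS_eq_seamSeq (hp : 0 < p) (hq : 0 < q) :
    sturmS p q = seamSeq p (p + q) 0 (-1) := by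
  funext i
  have key : (∃ n, i = cellStart (cellLenS p q) n) ↔
      (if i ≤ 0 then (0 - i * p) % (p + q) < p else (-1 - i * p) % (p + q) < p) := by
    simp only [cellStart_cellLenS hp hq, emod_lt_iff_exists hp (show p ≤ p + q by lia)]
    have hL := eq_add_ediv_iff (q := q) hp i
    have hR : ∀ n, i = n + (-(-(n * q) / p) - 1) ↔
        0 ≤ -1 - i * p + n * (p + q) ∧ -1 - i * p + n * (p + q) < p := fun n => by
      have := eq_add_neg_ediv_iff (q := q) hp (i + 1) n
      rw [add_sub_cancel_right] at this
      rw [← this]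
      constructor <;> intro h <;> linarith
    split_ifs with hi
    · constructor
      · rintro ⟨n, hn⟩
        split_ifs at hn with h
        · exact ⟨n, by simpa using (hL n).1 hn⟩
        · obtain ⟨h1, h2⟩ := (hR n).1 hn
          have : i = 0 ∨ i ≤ -1 := by lia
          rcases this with rfl | h3
          · nlinarith
          · nlinarith
      · rintro ⟨n, h1, h2⟩
        refine ⟨n, ?_⟩
        have : n ≤ 0 := by
          by_contra!
          nlinarith
        rw [if_pos this, hL]
        constructor <;> linarith
    · constructor
      · rintro ⟨n, hn⟩
        split_ifs at hn with h
        · obtain ⟨h1, h2⟩ := (hL n).1 hn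
          nlinarith
        · exact ⟨n, (hR n).1 hn⟩
      · rintro ⟨n, h1, h2⟩
        refine ⟨n, ?_⟩
        have : ¬ n ≤ 0 := by
          intro h
          nlinarith
        rw [if_neg this, hR]
        exact ⟨h1, h2⟩
  simp only [sturmS, seqOfCells, seamSeq, phaseSeq, key]
  split_ifs <;> rfl

lemma shiftZ_one_sturmS'_eq_seamSeq (hp : 0 < p) (hq : 0 < q) :
    shiftZ 1 (sturmS' p q) = seamSeq p (p + q) (-1) 0 := by
  funext i
  have key : (∃ n, i + 1 = cellStart (cellLenS' p q) n) ↔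
      (if i ≤ 0 then (-1 - i * p) % (p + q) < p else (0 - i * p) % (p + q) < p) := by
    simp only [cellStart_cellLenS' hp hq, emod_lt_iff_exists hp (show p ≤ p + q by lia)]
    have hL : ∀ n, i + 1 = n + (n * q / p + 1) ↔
        0 ≤ -(i * p) + n * (p + q) ∧ -(i * p) + n * (p + q) < p := fun n => by
      rw [← eq_add_ediv_iff hp, ← add_assoc, add_left_inj]
    have hR := eq_add_neg_ediv_iff (q := q) hp (i + 1)
    simp only [add_sub_cancel_right] at hR
    split_ifs with hi
    · constructor
      · rintro ⟨n, hn⟩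
        split_ifs at hn with h
        · exact ⟨n, (hR n).1 hn⟩
        · obtain ⟨h1, h2⟩ := (hL n).1 hn
          nlinarith
      · rintro ⟨n, h1, h2⟩
        refine ⟨n, ?_⟩
        have : n ≤ 0 := by
          by_contra!
          nlinarith
        rw [if_pos this, hR]
        exact ⟨h1, h2⟩
    · constructor
      · rintro ⟨n, hn⟩
        split_ifs at hn with h
        · obtain ⟨h1, h2⟩ := (hR n).1 hn
          nlinarith
        · exact ⟨n, by simpa using (hL n).1 hn⟩
      · rintro ⟨n, h1, h2⟩
        refine ⟨n, ?_⟩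
        have : ¬ n ≤ 0 := by
          intro h
          nlinarith
        rw [if_neg this, hL]
        constructor <;> linarith
  simp only [shiftZ, sturmS', seqOfCells, seamSeq, phaseSeq, key]
  split_ifs <;> rfl

end Cells

lemma phaseSeq_congr {p N c c' : ℤ} (h : N ∣ c - c') : phaseSeq p N c = phaseSeq p N c' := by
  funext i
  have : (c - i * p) % N = (c' - i * p) % N :=
    Int.emod_eq_emod_iff_emod_sub_eq_zero.2 (Int.emod_eq_zero_of_dvd (by simpa using h))
  simp only [phaseSeq, this]

lemma shiftZ_phaseSeq (p N c k : ℤ) : shiftZ k (phaseSeq p N c) = phaseSeq p N (c - k * p) := by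
  funext i
  simp only [shiftZ, phaseSeq]
  ring_nf

lemma shiftZ_zero {A : Type*} (x : ℤ → A) : shiftZ 0 x = x := by
  funext i
  simp only [shiftZ, add_zero]

lemma shiftZ_shiftZ {A : Type*} (k l : ℤ) (x : ℤ → A) :
    shiftZ k (shiftZ l x) = shiftZ (k + l) x := by
  funext i
  simp only [shiftZ, add_assoc]

lemma exists_mem_window_dvd {p N : ℤ} (hN : 0 < N) (h : IsCoprime p N) (c m : ℤ) :
    ∃ i, m ≤ i ∧ i < m + N ∧ N ∣ c - i * p := by
  obtain ⟨u, v, huv⟩ := h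
  have h0 := Int.emod_nonneg (u * c - m) hN.ne'
  have h1 := Int.emod_lt_of_pos (u * c - m) hN
  have h2 := Int.emod_add_mul_ediv (u * c - m) N
  refine ⟨m + (u * c - m) % N, by lia, by lia, v * c + (u * c - m) / N * p, ?_⟩
  have h3 : (u * c - m) % N = u * c - m - N * ((u * c - m) / N) := by lia
  rw [h3]
  linear_combination -c * huv

/-- The phase of a periodic coding is determined modulo `N` by any window of length `N`. -/
lemma dvd_sub_of_phaseSeq_eq_on_window {p N : ℤ} (hp : 0 < p) (hpN : p < N) (h : IsCoprime p N)
    {c c' : ℤ} (m : ℤ)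
    (heq : ∀ i, m ≤ i → i < m + N → phaseSeq p N c i = phaseSeq p N c' i) : N ∣ c - c' := by
  obtain ⟨i, hi1, hi2, hi⟩ := exists_mem_window_dvd (by lia) h c m
  obtain ⟨j, hj1, hj2, hj⟩ := exists_mem_window_dvd (by lia) h (c + 1) m
  have ei := heq i hi1 hi2
  have ej := heq j hj1 hj2
  have ci : (c' - i * p) % N = (c' - c) % N := by
    obtain ⟨t, ht⟩ := hi
    rw [show c' - i * p = c' - c + N * t by rw [← ht]; ring, Int.add_mul_emod_self_left]
  have cj : (c' - j * p) % N = (c' - c - 1) % N := by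
    obtain ⟨t, ht⟩ := hj
    rw [show c' - j * p = c' - c - 1 + N * t by rw [← ht]; ring, Int.add_mul_emod_self_left]
  have cj' : (c - j * p) % N = N - 1 := by
    obtain ⟨t, ht⟩ := hj
    rw [show c - j * p = N - 1 + N * (t - 1) by linear_combination ht, Int.add_mul_emod_self_left,
      Int.emod_eq_of_lt (by lia) (by lia)]
  simp only [phaseSeq, Int.emod_eq_zero_of_dvd hi, ci, if_pos hp] at ei
  simp only [phaseSeq, cj, cj', if_neg (show ¬ N - 1 < p by lia)] at ej
  have hi' : (c' - c) % N < p := by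
    by_contra hh
    simp [hh] at ei
  have hj' : ¬ (c' - c - 1) % N < p := by
    intro hh
    simp [hh] at ej
  rw [← dvd_neg, neg_sub]
  refine Int.dvd_of_emod_eq_zero ?_
  by_contra hne
  have h0 := Int.emod_nonneg (c' - c) (show N ≠ 0 by lia)
  have : (c' - c - 1) % N = (c' - c) % N - 1 := by
    rw [← Int.emod_sub_emod, Int.emod_eq_of_lt (by lia) (by lia)]
  lia

lemma phaseSeq_eq_iff {p N : ℤ} (hp : 0 < p) (hpN : p < N) (h : IsCoprime p N) {c c' : ℤ} :
    phaseSeq p N c = phaseSeq p N c' ↔ N ∣ c - c' :=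
  ⟨fun heq => dvd_sub_of_phaseSeq_eq_on_window hp hpN h 0 fun i _ _ => congrFun heq i,
    phaseSeq_congr⟩

lemma rev_phaseSeq {p N : ℤ} (hN : 0 < N) (c i : ℤ) :
    Fin.rev (phaseSeq p N c i) = phaseSeq (N - p) N (-1 - c) i := by
  have h0 := Int.emod_nonneg (c - i * p) hN.ne'
  have h1 := Int.emod_lt_of_pos (c - i * p) hN
  have h2 := Int.emod_add_mul_ediv (c - i * p) N
  have : (-1 - c - i * (N - p)) % N = N - 1 - (c - i * p) % N := by
    rw [show -1 - c - i * (N - p)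
      = N - 1 - (c - i * p) % N + N * (-i - 1 - (c - i * p) / N) by linear_combination h2,
      Int.add_mul_emod_self_left, Int.emod_eq_of_lt (by lia) (by lia)]
  simp only [phaseSeq, this]
  split_ifs <;> first | rfl | lia

lemma rev_seamSeq {p N : ℤ} (hN : 0 < N) (a b i : ℤ) :
    Fin.rev (seamSeq p N a b i) = seamSeq (N - p) N (-1 - a) (-1 - b) i := by
  unfold seamSeq
  split_ifs <;> exact rev_phaseSeq hN _ _

/-- A window around the seam determines the position in the orbit. -/
lemma shiftZ_seamSeq_eq_on_window {p N a b : ℤ} (hp : 0 < p) (hpN : p < N) (h : IsCoprime p N)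
    (hab : ¬ N ∣ a - b) {k : ℤ}
    (heq : ∀ i ∈ Finset.Ioc (-N) N,
      shiftZ k (seamSeq p N a b) i = seamSeq p N a b i) : k = 0 := by
  have period : ∀ c, N ∣ k * p → ∀ i, phaseSeq p N c (i + k) = phaseSeq p N c i := by
    intro c hk i
    have := congrFun (shiftZ_phaseSeq p N c k) i
    rwa [phaseSeq_congr (c := c - k * p) (c' := c) (by simpa using hk)] at this
  have dvd_k : N ∣ k * p → N ∣ k := fun hk => h.symm.dvd_of_dvd_mul_right hk
  rcases lt_trichotomy k 0 with hk | hk | hk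
  · have hkp : N ∣ k * p := by
      have := dvd_sub_of_phaseSeq_eq_on_window hp hpN h (c := a - k * p) (c' := a) (-N + 1)
        fun i h1 h2 => by
          have := heq i (by simp; lia)
          simp only [seamSeq, shiftZ, if_pos (show i ≤ 0 by lia),
            if_pos (show i + k ≤ 0 by lia)] at this
          rw [← shiftZ_phaseSeq]
          exact this
      simpa using this
    have hkN : N ≤ -k := Int.le_of_dvd (by lia) ((dvd_neg).2 (dvd_k hkp))
    refine (hab (dvd_sub_of_phaseSeq_eq_on_window hp hpN h 1 fun i h1 h2 => ?_)).elim
    have := heq i (by simp; lia)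
    simp only [seamSeq, shiftZ, if_neg (show ¬ i ≤ 0 by lia),
      if_pos (show i + k ≤ 0 by lia)] at this
    rw [← this, period a hkp]
  · exact hk
  · have hkp : N ∣ k * p := by
      have := dvd_sub_of_phaseSeq_eq_on_window hp hpN h (c := b - k * p) (c' := b) 1
        fun i h1 h2 => by
          have := heq i (by simp; lia)
          simp only [seamSeq, shiftZ, if_neg (show ¬ i ≤ 0 by lia),
            if_neg (show ¬ i + k ≤ 0 by lia)] at this
          rw [← shiftZ_phaseSeq]
          exact this
      simpa using this
    have hkN : N ≤ k := Int.le_of_dvd (by lia) (dvd_k hkp)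
    refine (hab (dvd_sub_of_phaseSeq_eq_on_window hp hpN h (-N + 1) fun i h1 h2 => ?_)).elim
    have := heq i (by simp; lia)
    simp only [seamSeq, shiftZ, if_pos (show i ≤ 0 by lia),
      if_neg (show ¬ i + k ≤ 0 by lia)] at this
    rw [← this, period b hkp]

section Subshift

variable {A B : Type*} [TopologicalSpace A] [TopologicalSpace B]

lemma continuous_shiftZ (k : ℤ) : Continuous (shiftZ k : (ℤ → A) → ℤ → A) :=
  continuous_pi fun i => continuous_apply (i + k)

lemma shiftZ_mem_subshiftGen (k : ℤ) (x : ℤ → A) : shiftZ k x ∈ subshiftGen x :=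
  subset_closure ⟨k, rfl⟩

lemma self_mem_subshiftGen (x : ℤ → A) : x ∈ subshiftGen x := by
  simpa only [shiftZ_zero] using shiftZ_mem_subshiftGen 0 x

lemma shiftZ_mem_of_mem_subshiftGen {x u : ℤ → A} (k : ℤ) (hu : u ∈ subshiftGen x) :
    shiftZ k u ∈ subshiftGen x := by
  refine map_mem_closure (continuous_shiftZ k) hu ?_
  rintro _ ⟨l, rfl⟩
  exact ⟨k + l, shiftZ_shiftZ k l x⟩

lemma subshiftGen_shiftZ (k : ℤ) (x : ℤ → A) : subshiftGen (shiftZ k x) = subshiftGen x := by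
  unfold subshiftGen
  congr 1
  ext y
  constructor
  · rintro ⟨l, rfl⟩
    exact ⟨l + k, shiftZ_shiftZ l k x⟩
  · rintro ⟨l, rfl⟩
    exact ⟨l - k, by rw [shiftZ_shiftZ, sub_add_cancel]⟩

/-- Applying a homeomorphism of alphabets letter by letter is a conjugacy. -/
lemma conjugate_subshiftGen_comp (e : A ≃ₜ B) (x : ℤ → A) :
    Conjugate (subshiftGen x) (subshiftGen (e ∘ x)) := by
  let E : (ℤ → A) ≃ₜ (ℤ → B) := Homeomorph.piCongrRight fun _ => e
  have hE : E '' subshiftGen x = subshiftGen (e ∘ x) := by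
    unfold subshiftGen
    rw [E.image_closure]
    congr 1
    ext y
    constructor
    · rintro ⟨_, ⟨k, rfl⟩, rfl⟩
      exact ⟨k, rfl⟩
    · rintro ⟨k, rfl⟩
      exact ⟨_, ⟨k, rfl⟩, rfl⟩
  refine ⟨E.subtype fun y => ?_, fun u hu hu' => rfl⟩
  rw [← hE]
  exact (E.injective.mem_set_image).symm

lemma conjugacy_shiftZ {x : ℤ → A} {Y : Set (ℤ → B)} (φ : subshiftGen x ≃ₜ Y)
    (hφ : ∀ (u : ℤ → A) (hu : u ∈ subshiftGen x) (hu' : shiftMap u ∈ subshiftGen x),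
      ((φ ⟨shiftMap u, hu'⟩ : Y) : ℤ → B) = shiftMap ((φ ⟨u, hu⟩ : Y) : ℤ → B))
    (k : ℤ) (u : ℤ → A) (hu : u ∈ subshiftGen x) :
    (φ ⟨shiftZ k u, shiftZ_mem_of_mem_subshiftGen k hu⟩ : ℤ → B) = shiftZ k (φ ⟨u, hu⟩) := by
  have step : ∀ k : ℤ,
      (φ ⟨shiftZ (k + 1) u, shiftZ_mem_of_mem_subshiftGen (k + 1) hu⟩ : ℤ → B)
        = shiftZ 1 (φ ⟨shiftZ k u, shiftZ_mem_of_mem_subshiftGen k hu⟩) := by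
    intro k
    have e : shiftZ (k + 1) u = shiftMap (shiftZ k u) := by
      rw [add_comm, ← shiftZ_shiftZ]
      rfl
    have hm := shiftZ_mem_of_mem_subshiftGen (k + 1) hu
    rw [e] at hm
    simp only [e]
    exact hφ _ _ hm
  induction k with
  | zero => simp only [shiftZ_zero]
  | succ n ih => rw [step, ih, shiftZ_shiftZ, add_comm]
  | pred n ih =>
    have h := step (-(n : ℤ) - 1)
    simp only [sub_add_cancel] at h
    rw [ih] at h
    have h' := congrArg (shiftZ (-1)) h
    rw [shiftZ_shiftZ, shiftZ_shiftZ] at h'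
    rw [show -(n : ℤ) - 1 = -1 + -n by ring] at h' ⊢
    rw [h', neg_add_cancel, shiftZ_zero]

/-- A homeomorphism sends an isolated point of a subshift into the orbit generating the target. -/
lemma exists_eq_shiftZ_of_isOpen_singleton {X : Set (ℤ → A)} {y : ℤ → B}
    (φ : X ≃ₜ subshiftGen y) {u : X} (hu : IsOpen ({u} : Set X)) :
    ∃ k, (φ u : ℤ → B) = shiftZ k y := by
  have h1 : IsOpen ({φ u} : Set (subshiftGen y)) := by
    rw [← Set.image_singleton]
    exact φ.isOpenMap _ hu
  obtain ⟨V, hV, hVu⟩ := isOpen_induced_iff.1 h1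
  have hmem : φ u ∈ Subtype.val ⁻¹' V := by rw [hVu]; rfl
  obtain ⟨z, hzV, k, rfl⟩ := mem_closure_iff.1 (φ u).2 V hV hmem
  have : (⟨shiftZ k y, shiftZ_mem_subshiftGen k y⟩ : subshiftGen y) ∈ Subtype.val ⁻¹' V := hzV
  rw [hVu, Set.mem_singleton_iff] at this
  exact ⟨k, by rw [← this]⟩

end Subshift

open Filter Topology

lemma isOpen_singleton_seamSeq {p N a b : ℤ} (hp : 0 < p) (hpN : p < N) (h : IsCoprime p N)
    (hab : ¬ N ∣ a - b) :
    IsOpen ({⟨seamSeq p N a b, self_mem_subshiftGen _⟩} :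
      Set (subshiftGen (seamSeq p N a b))) := by
  set x := seamSeq p N a b
  let U : Set (ℤ → Fin 2) := {y | ∀ i ∈ Finset.Ioc (-N) N, y i = x i}
  have hU : IsOpen U := by
    have : U = ⋂ i ∈ Finset.Ioc (-N) N, (fun y : ℤ → Fin 2 => y i) ⁻¹' {x i} := by
      ext y
      simp [U]
    rw [this]
    exact isOpen_biInter_finset fun i _ => (isOpen_discrete _).preimage (continuous_apply i)
  refine isOpen_induced_iff.2 ⟨U, hU, ?_⟩
  ext ⟨y, hy⟩
  simp only [Set.mem_preimage, Set.mem_singleton_iff, Subtype.mk.injEq]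
  constructor
  · intro hyU
    have h1 : y ∈ closure (U ∩ seqOrbit x) := hU.inter_closure ⟨hyU, hy⟩
    have h2 : U ∩ seqOrbit x ⊆ {x} := by
      rintro _ ⟨hz, k, rfl⟩
      have := shiftZ_seamSeq_eq_on_window hp hpN h hab hz
      subst this
      simp [shiftZ_zero]
    simpa using closure_mono h2 h1
  · rintro rfl i _
    rfl

lemma tendsto_shiftZ_seamSeq_left {p N M : ℤ} (hM : 0 < M) (hNM : N ∣ M) (a b k : ℤ) :
    Tendsto (fun j : ℕ => shiftZ (-(j * M)) (shiftZ k (seamSeq p N a b))) atTop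
      (𝓝 (phaseSeq p N (a - k * p))) := by
  refine tendsto_pi_nhds.2 fun i => tendsto_const_nhds.congr' ?_
  filter_upwards [eventually_ge_atTop (i + k).toNat] with j hj
  have : i + -(j * M) + k ≤ 0 := by
    have : (j : ℤ) ≤ j * M := le_mul_of_one_le_right (by lia) hM
    lia
  rw [phaseSeq_congr (c' := a - (-(j * M) + k) * p), ← shiftZ_phaseSeq]
  · rw [add_assoc] at this
    simp only [shiftZ, seamSeq, add_assoc, if_pos this]
  · rw [show a - k * p - (a - (-(j * M) + k) * p) = M * (-(j * p)) by ring]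
    exact hNM.mul_right _

lemma tendsto_shiftZ_seamSeq_right {p N M : ℤ} (hM : 0 < M) (hNM : N ∣ M) (a b k : ℤ) :
    Tendsto (fun j : ℕ => shiftZ (j * M) (shiftZ k (seamSeq p N a b))) atTop
      (𝓝 (phaseSeq p N (b - k * p))) := by
  refine tendsto_pi_nhds.2 fun i => tendsto_const_nhds.congr' ?_
  filter_upwards [eventually_ge_atTop (1 - (i + k)).toNat] with j hj
  have : ¬ i + j * M + k ≤ 0 := by
    have : (j : ℤ) ≤ j * M := le_mul_of_one_le_right (by lia) hM
    lia
  rw [phaseSeq_congr (c' := b - (j * M + k) * p), ← shiftZ_phaseSeq]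
  · rw [add_assoc] at this
    simp only [shiftZ, seamSeq, add_assoc, if_neg this]
  · rw [show b - k * p - (b - (j * M + k) * p) = M * (j * p) by ring]
    exact hNM.mul_right _

/-- A conjugacy carries limits along a sequence of shifts to limits along the same shifts. -/
lemma conjugacy_eq_of_tendsto {A B : Type*} [TopologicalSpace A] [TopologicalSpace B] [T2Space B]
    {x : ℤ → A} {Y : Set (ℤ → B)} (φ : subshiftGen x ≃ₜ Y)
    (hφ : ∀ (u : ℤ → A) (hu : u ∈ subshiftGen x) (hu' : shiftMap u ∈ subshiftGen x),
      ((φ ⟨shiftMap u, hu'⟩ : Y) : ℤ → B) = shiftMap ((φ ⟨u, hu⟩ : Y) : ℤ → B))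
    {f : ℕ → ℤ} {u : ℤ → A} {w : ℤ → B} (hu : u ∈ subshiftGen x)
    (hx : Tendsto (fun j => shiftZ (f j) x) atTop (𝓝 u))
    (hy : Tendsto (fun j => shiftZ (f j) (φ ⟨x, self_mem_subshiftGen x⟩ : ℤ → B)) atTop (𝓝 w)) :
    (φ ⟨u, hu⟩ : ℤ → B) = w := by
  have h1 : Tendsto (fun j => (⟨shiftZ (f j) x, shiftZ_mem_subshiftGen (f j) x⟩ : subshiftGen x))
      atTop (𝓝 ⟨u, hu⟩) := tendsto_subtype_rng.2 hx
  have h2 := ((continuous_subtype_val.comp φ.continuous).tendsto _).comp h1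
  refine tendsto_nhds_unique h2 (hy.congr fun j => ?_)
  exact (conjugacy_shiftZ φ hφ (f j) x (self_mem_subshiftGen x)).symm

/-- Conjugate seam subshifts have the same period, and their phase jumps correspond. -/
lemma dvd_of_conjugate_seamSeq {p N a b p' N' a' b' : ℤ} (hp : 0 < p) (hpN : p < N)
    (h : IsCoprime p N) (hab : ¬ N ∣ a - b) (hp' : 0 < p') (hpN' : p' < N')
    (h' : IsCoprime p' N')
    (hconj : Conjugate (subshiftGen (seamSeq p N a b)) (subshiftGen (seamSeq p' N' a' b'))) :
    N = N' ∧ N ∣ (a - b) * p' - (a' - b') * p := by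
  obtain ⟨φ, hφ⟩ := hconj
  obtain ⟨k, hk⟩ := exists_eq_shiftZ_of_isOpen_singleton φ
    (isOpen_singleton_seamSeq hp hpN h hab)
  have hN : 0 < N := by lia
  have hN' : 0 < N' := by lia
  have hM : 0 < N * N' := mul_pos hN hN'
  have tl := tendsto_shiftZ_seamSeq_left (p := p) hM (Dvd.intro N' rfl) a b 0
  have tr := tendsto_shiftZ_seamSeq_right (p := p) hM (Dvd.intro N' rfl) a b 0
  simp only [shiftZ_zero, zero_mul, sub_zero] at tl tr
  have ma : phaseSeq p N a ∈ subshiftGen (seamSeq p N a b) :=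
    isClosed_closure.mem_of_tendsto tl (Eventually.of_forall fun j => shiftZ_mem_subshiftGen _ _)
  have mb : phaseSeq p N b ∈ subshiftGen (seamSeq p N a b) :=
    isClosed_closure.mem_of_tendsto tr (Eventually.of_forall fun j => shiftZ_mem_subshiftGen _ _)
  have ea := conjugacy_eq_of_tendsto φ hφ ma tl (by
    rw [hk]
    exact tendsto_shiftZ_seamSeq_left hM (Dvd.intro_left N rfl) a' b' k)
  have eb := conjugacy_eq_of_tendsto φ hφ mb tr (by
    rw [hk]
    exact tendsto_shiftZ_seamSeq_right hM (Dvd.intro_left N rfl) a' b' k)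
  have transfer : ∀ (r c c' : ℤ) (hc : phaseSeq p N c ∈ subshiftGen (seamSeq p N a b)),
      (φ ⟨phaseSeq p N c, hc⟩ : ℤ → Fin 2) = phaseSeq p' N' c' →
      ((N ∣ a - r * p - c) ↔ N' ∣ a' - k * p' - r * p' - c') := by
    intro r c c' hc hcc
    rw [← phaseSeq_eq_iff hp hpN h, ← phaseSeq_eq_iff hp' hpN' h', ← shiftZ_phaseSeq,
      ← shiftZ_phaseSeq, ← ea, ← hcc, ← conjugacy_shiftZ φ hφ]
    simp only [Subtype.coe_inj, EmbeddingLike.apply_eq_iff_eq, Subtype.mk.injEq]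
  have hper : ∀ r, N ∣ r ↔ N' ∣ r := by
    intro r
    have := transfer r a _ ma ea
    rw [show a - r * p - a = -(r * p) by ring,
      show a' - k * p' - r * p' - (a' - k * p') = -(r * p') by ring, dvd_neg, dvd_neg] at this
    exact ⟨fun hr => h'.symm.dvd_of_dvd_mul_right (this.1 (hr.mul_right p)),
      fun hr => h.symm.dvd_of_dvd_mul_right (this.2 (hr.mul_right p'))⟩
  have hNN : N = N' := Int.dvd_antisymm hN.le hN'.le ((hper N').2 dvd_rfl) ((hper N).1 dvd_rfl)
  refine ⟨hNN, ?_⟩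
  subst hNN
  obtain ⟨r, -, -, hr⟩ := exists_mem_window_dvd hN h (a - b) 0
  have hr' := (transfer r b _ mb eb).1 (by
    rwa [show a - r * p - b = a - b - r * p by ring])
  have := (hr.mul_right p').sub (hr'.mul_right p)
  rwa [show (a - b - r * p) * p' - (a' - k * p' - r * p' - (b' - k * p')) * p
    = (a - b) * p' - (a' - b') * p by ring] at this

/-- The subshift generated by `S(0,q/p)` is conjugate to the subshift
generated by `S′(0,q′/p′)` iff `q′ = p` and `p′ = q` (inverse frequencies). -/
theorem stmt_17 (p q p' q' : ℤ) (hp : 0 < p) (hq : 0 < q) (hpq : IsCoprime p q)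
    (hp' : 0 < p') (hq' : 0 < q') (hpq' : IsCoprime p' q') :
    Conjugate (subshiftGen (sturmS p q)) (subshiftGen (sturmS' p' q')) ↔
      (q' = p ∧ p' = q) := by
  have hcop : ∀ {m n : ℤ}, IsCoprime m n → IsCoprime m (m + n) := fun {m n} h => by
    simpa [add_comm] using (IsCoprime.add_mul_left_right_iff (z := 1)).2 h
  rw [sturmS_eq_seamSeq hp hq, ← subshiftGen_shiftZ 1 (sturmS' p' q'),
    shiftZ_one_sturmS'_eq_seamSeq hp' hq']
  constructor
  · intro hconj
    have hnd : ¬ (p + q) ∣ 0 - -1 := fun h => by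
      have := Int.le_of_dvd (by lia) h
      lia
    obtain ⟨hN, hdvd⟩ := dvd_of_conjugate_seamSeq hp (by lia) (hcop hpq) hnd hp' (by lia)
      (hcop hpq') hconj
    obtain ⟨t, ht⟩ := hdvd
    have ht0 : 0 < t := by
      by_contra!
      nlinarith
    have ht1 : t < 2 := by
      by_contra!
      nlinarith
    obtain rfl : t = 1 := by lia
    lia
  · rintro ⟨rfl, rfl⟩
    have hrev : seamSeq p' (p' + q') (-1) 0
        = (Homeomorph.mk Fin.revPerm continuous_of_discreteTopology
          continuous_of_discreteTopology : Fin 2 ≃ₜ Fin 2) ∘ seamSeq q' (q' + p') 0 (-1) := by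
      funext i
      have := rev_seamSeq (p := q') (N := q' + p') (by lia) 0 (-1) i
      simp only [add_sub_cancel_left] at this
      rw [add_comm p' q']
      exact this.symm
    rw [hrev]
    exact conjugate_subshiftGen_comp _ _
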